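/- Suppose Ω ≠ 0 and the blockade structure is fully-symmetric, i.e. the automorphism group of the vertex-weighted graph (G, Δ) acts transitively on the set L of configurations of maximum-weight independent sets. Then the ground state of the blockade Hamiltonian H(Ω) is unique up to scaling, the ground eigenvector v satisfies U_φ v = v for every automorphism φ, and there exists a scalar λ such that v_n = λ for every configuration n ∈ L (an equal-weight superposition of all logical states). -/

import Mathlib

/-- Number of edges `{i,j}` of `G` with both endpoints excited in configuration `n`. -/
def excitedEdgeCount {N : ℕ} (G : SimpleGraph (Fin N)) [DecidableRel G.Adj]
    (n : Fin N → Bool) : ℕ :=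
  (Finset.univ.filter fun p : Fin N × Fin N =>
    p.1 < p.2 ∧ G.Adj p.1 p.2 ∧ n p.1 = true ∧ n p.2 = true).card

/-- The blockade Hamiltonian `H(Ω)` indexed by configurations `n ∈ {0,1}^N`. -/
noncomputable def blockadeH {N : ℕ} (G : SimpleGraph (Fin N)) [DecidableRel G.Adj]
    (Δ : Fin N → ℝ) (U₀ Ω : ℝ) : Matrix (Fin N → Bool) (Fin N → Bool) ℝ :=
  Matrix.of fun n n' =>
    if n = n' then
      U₀ * (excitedEdgeCount G n : ℝ) - ∑ i, Δ i * (if n i = true then (1 : ℝ) else 0)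
    else if hammingDist n n' = 1 then Ω else 0

/-- The action of a permutation of the vertices on configurations: `(φ·n)_i = n_{φ(i)}`. -/
def confAct {N : ℕ} (φ : Equiv.Perm (Fin N)) (n : Fin N → Bool) : Fin N → Bool :=
  fun i => n (φ i)

/-- The permutation matrix `U_φ` determined by `U_φ e_n = e_{φ·n}`. -/
def permMatrix {N : ℕ} (R : Type*) [Zero R] [One R] (φ : Equiv.Perm (Fin N)) :
    Matrix (Fin N → Bool) (Fin N → Bool) R :=
  Matrix.of fun m n => if m = confAct φ n then 1 else 0

/-- An automorphism of the vertex-weighted graph `(G, Δ)`. -/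
def IsBlockadeAut {N : ℕ} (G : SimpleGraph (Fin N)) (Δ : Fin N → ℝ)
    (φ : Equiv.Perm (Fin N)) : Prop :=
  (∀ i, Δ (φ i) = Δ i) ∧ ∀ i j, G.Adj (φ i) (φ j) ↔ G.Adj i j

/-- An independent set of `G`: a vertex subset containing no edge. -/
def IsIndepSet {N : ℕ} (G : SimpleGraph (Fin N)) (I : Finset (Fin N)) : Prop :=
  ∀ i ∈ I, ∀ j ∈ I, ¬ G.Adj i j

/-- A maximum-weight independent set of the vertex-weighted graph `(G, Δ)`. -/
def IsMWIS {N : ℕ} (G : SimpleGraph (Fin N)) (Δ : Fin N → ℝ) (I : Finset (Fin N)) : Prop :=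
  IsIndepSet G I ∧ ∀ J : Finset (Fin N), IsIndepSet G J → ∑ j ∈ J, Δ j ≤ ∑ i ∈ I, Δ i

/-- The set `L` of configurations that are indicator vectors of MWISs. -/
def mwisConfigs {N : ℕ} (G : SimpleGraph (Fin N)) (Δ : Fin N → ℝ) : Set (Fin N → Bool) :=
  {n | IsMWIS G Δ (Finset.univ.filter fun i => n i = true)}

open Matrix Finset

section PerronFrobenius

variable {ι : Type*} [Fintype ι]

/-- A real matrix whose off-diagonal entries become nonpositive after conjugation by the diagonal
sign matrix `s` does not increase its quadratic form when `v` is replaced by `s |v|`. -/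
theorem dotProduct_mulVec_sign_abs_le {M : Matrix ι ι ℝ} {s : ι → ℝ}
    (hs : ∀ i, s i * s i = 1) (hM : ∀ i j, i ≠ j → s i * s j * M i j = -|M i j|) (v : ι → ℝ) :
    (fun i => s i * |v i|) ⬝ᵥ M *ᵥ (fun i => s i * |v i|) ≤ v ⬝ᵥ M *ᵥ v := by
  simp only [dotProduct, mulVec, mul_sum]
  refine sum_le_sum fun i _ => sum_le_sum fun j _ => ?_
  rcases eq_or_ne i j with rfl | hij
  · refine le_of_eq ?_
    linear_combination (M i i * |v i| * |v i|) * hs i + M i i * abs_mul_abs_self (v i)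
  · calc s i * |v i| * (M i j * (s j * |v j|))
        = -(|v i * (M i j * v j)|) := by
          rw [abs_mul, abs_mul]
          linear_combination (|v i| * |v j|) * hM i j hij
      _ ≤ v i * (M i j * v j) := neg_abs_le _

/-- Perron–Frobenius: a nonzero kernel vector of an irreducible positive semidefinite matrix, whose
off-diagonal entries are nonpositive up to conjugation by a sign matrix, vanishes nowhere. -/
theorem Matrix.PosSemidef.ne_zero_of_mulVec_eq_zero {M : Matrix ι ι ℝ} (hpos : M.PosSemidef)
    {s : ι → ℝ} (hs : ∀ i, s i * s i = 1) (hM : ∀ i j, i ≠ j → s i * s j * M i j = -|M i j|)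
    (hconn : ∀ i j, Relation.ReflTransGen (fun i j => M i j ≠ 0) i j)
    {v : ι → ℝ} (hv : v ≠ 0) (hMv : M *ᵥ v = 0) (i : ι) : v i ≠ 0 := by
  have hker : M *ᵥ (fun i => s i * |v i|) = 0 := by
    refine (hpos.dotProduct_mulVec_zero_iff _).1 (le_antisymm ?_ (hpos.dotProduct_mulVec_nonneg _))
    simpa [hMv] using dotProduct_mulVec_sign_abs_le hs hM v
  have hstep : ∀ i j, v i = 0 → M i j ≠ 0 → v j = 0 := by
    intro i j hi hij
    have h0 : ∑ k, |M i k| * |v k| = 0 := by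
      have h := congrFun hker i
      simp only [mulVec, dotProduct, Pi.zero_apply] at h
      rw [← neg_eq_zero, ← sum_neg_distrib, ← mul_zero (s i), ← h, mul_sum]
      refine sum_congr rfl fun k _ => ?_
      rcases eq_or_ne i k with rfl | hik
      · simp [hi]
      · linear_combination (-|v k|) * hM i k hik
    have h := (sum_eq_zero_iff_of_nonneg fun k _ => by positivity).1 h0 j (mem_univ j)
    simpa [hij] using h
  intro hi
  refine hv (funext fun j => ?_)
  induction hconn i j with
  | refl => exact hi
  | tail _ hab ih => exact hstep _ _ ih hab

/-- A symmetric real matrix shifted by a lower bound of its spectrum is positive semidefinite. -/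
theorem Matrix.IsSymm.posSemidef_sub_smul_one [DecidableEq ι] {A : Matrix ι ι ℝ} (hA : A.IsSymm)
    {μ : ℝ} (hmin : ∀ μ' : ℝ, Module.End.HasEigenvalue (Matrix.toLin' A) μ' → μ ≤ μ') :
    (A - μ • (1 : Matrix ι ι ℝ)).PosSemidef := by
  have hherm : (A - μ • (1 : Matrix ι ι ℝ)).IsHermitian := by
    simp [Matrix.IsHermitian, conjTranspose_eq_transpose_of_trivial, hA.eq]
  refine hherm.posSemidef_iff_eigenvalues_nonneg.2 fun i => ?_
  have h := hherm.mulVec_eigenvectorBasis i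
  rw [sub_mulVec, smul_mulVec, one_mulVec, sub_eq_iff_eq_add, ← add_smul] at h
  refine le_of_add_le_add_right (a := μ) ?_
  rw [Pi.zero_apply, zero_add]
  refine hmin _ (Module.End.hasEigenvalue_of_hasEigenvector
    (x := (hherm.eigenvectorBasis i).ofLp) ⟨?_, ?_⟩)
  · rw [Module.End.mem_eigenspace_iff, Matrix.toLin'_apply, h]
  · intro h0
    exact hherm.eigenvectorBasis.orthonormal.ne_zero i (WithLp.ofLp_injective 2 h0)

end PerronFrobenius

section Hypercube

variable {N : ℕ}

/-- The sign character `n ↦ σ ^ |n|` on configurations. -/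
def configSign (σ : ℝ) (n : Fin N → Bool) : ℝ :=
  ∏ i, if n i = true then σ else 1

theorem configSign_mul {σ : ℝ} (hσ : σ * σ = 1) (n m : Fin N → Bool) :
    configSign σ n * configSign σ m = σ ^ hammingDist n m := by
  rw [configSign, configSign, ← prod_mul_distrib, hammingDist, ← prod_const, prod_filter]
  refine prod_congr rfl fun i _ => ?_
  cases n i <;> cases m i <;> simp [hσ]

theorem hammingDist_update_eq_one {n : Fin N → Bool} {i : Fin N} {b : Bool} (h : n i ≠ b) :
    hammingDist n (Function.update n i b) = 1 := by
  rw [hammingDist, card_eq_one]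
  refine ⟨i, ?_⟩
  ext j
  rcases eq_or_ne j i with rfl | hj <;> simp_all

theorem reflTransGen_hammingDist_eq_one (n m : Fin N → Bool) :
    Relation.ReflTransGen (fun a b : Fin N → Bool => hammingDist a b = 1) n m := by
  suffices h : ∀ S : Finset (Fin N), Relation.ReflTransGen
      (fun a b : Fin N → Bool => hammingDist a b = 1) n (fun i => if i ∈ S then m i else n i) by
    simpa using h univ
  intro S
  induction S using Finset.induction_on with
  | empty => simpa using Relation.ReflTransGen.refl
  | insert a S ha ih =>
    have hupd : (fun i => if i ∈ insert a S then m i else n i)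
        = Function.update (fun i => if i ∈ S then m i else n i) a (m a) := by
      funext i
      rcases eq_or_ne i a with rfl | hi <;> simp_all
    rw [hupd]
    by_cases hna : n a = m a
    · rwa [Function.update_eq_self_iff.2 (by simp [ha, hna])]
    · exact ih.tail (hammingDist_update_eq_one (by simpa [ha] using hna))

/-- The action of a vertex permutation on configurations, as an equivalence. -/
def confActEquiv (φ : Equiv.Perm (Fin N)) : (Fin N → Bool) ≃ (Fin N → Bool) :=
  Equiv.arrowCongr φ.symm (Equiv.refl Bool)

@[simp]
theorem confActEquiv_apply (φ : Equiv.Perm (Fin N)) (n : Fin N → Bool) :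
    confActEquiv φ n = confAct φ n :=
  rfl

theorem permMatrix_mulVec_confAct (φ : Equiv.Perm (Fin N)) (v : (Fin N → Bool) → ℝ)
    (n : Fin N → Bool) : (permMatrix ℝ φ *ᵥ v) (confAct φ n) = v n := by
  simp_rw [← confActEquiv_apply]
  simp [mulVec, dotProduct, permMatrix, ← confActEquiv_apply]

theorem hammingDist_confAct (φ : Equiv.Perm (Fin N)) (n m : Fin N → Bool) :
    hammingDist (confAct φ n) (confAct φ m) = hammingDist n m := by
  refine card_equiv φ fun i => ?_
  rw [mem_filter_univ, mem_filter_univ, confAct, confAct]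

end Hypercube

section BlockadeHamiltonian

variable {N : ℕ} {G : SimpleGraph (Fin N)} [DecidableRel G.Adj]

theorem two_mul_excitedEdgeCount (n : Fin N → Bool) :
    2 * excitedEdgeCount G n = (univ.filter fun p : Fin N × Fin N =>
      G.Adj p.1 p.2 ∧ n p.1 = true ∧ n p.2 = true).card := by
  have hswap : excitedEdgeCount G n = (univ.filter fun p : Fin N × Fin N =>
      ¬ p.1 < p.2 ∧ G.Adj p.1 p.2 ∧ n p.1 = true ∧ n p.2 = true).card := by
    refine card_equiv (Equiv.prodComm _ _) fun p => ?_
    simp only [mem_filter, mem_univ, true_and, Equiv.prodComm_apply, Prod.fst_swap, Prod.snd_swap,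
      G.adj_comm p.2 p.1]
    constructor
    · rintro ⟨h, hadj, h₁, h₂⟩
      exact ⟨h.le.not_gt, hadj, h₂, h₁⟩
    · rintro ⟨h, hadj, h₁, h₂⟩
      exact ⟨lt_of_le_of_ne (not_lt.1 h) hadj.ne, hadj, h₂, h₁⟩
  rw [two_mul]
  nth_rewrite 2 [hswap]
  rw [excitedEdgeCount, ← card_filter_add_card_filter_not (s := univ.filter fun p : Fin N × Fin N =>
      G.Adj p.1 p.2 ∧ n p.1 = true ∧ n p.2 = true) (fun p => p.1 < p.2),
    filter_filter, filter_filter]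
  congr 2 <;> exact filter_congr fun p _ => and_comm

theorem IsBlockadeAut.excitedEdgeCount_confAct {Δ : Fin N → ℝ} {φ : Equiv.Perm (Fin N)}
    (hφ : IsBlockadeAut G Δ φ) (n : Fin N → Bool) :
    excitedEdgeCount G (confAct φ n) = excitedEdgeCount G n := by
  refine Nat.eq_of_mul_eq_mul_left two_pos ?_
  rw [two_mul_excitedEdgeCount, two_mul_excitedEdgeCount]
  refine card_equiv (Equiv.prodCongr φ φ) fun p => ?_
  rw [mem_filter_univ, mem_filter_univ]
  simp only [confAct, Equiv.prodCongr_apply, Prod.map_fst, Prod.map_snd, hφ.2]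

theorem IsBlockadeAut.blockadeH_confAct {Δ : Fin N → ℝ} {φ : Equiv.Perm (Fin N)}
    (hφ : IsBlockadeAut G Δ φ) (U₀ Ω : ℝ) (n m : Fin N → Bool) :
    blockadeH G Δ U₀ Ω (confAct φ n) (confAct φ m) = blockadeH G Δ U₀ Ω n m := by
  have hinj : confAct φ n = confAct φ m ↔ n = m := (confActEquiv φ).injective.eq_iff
  have hsum : ∑ i, Δ i * (if confAct φ n i = true then (1 : ℝ) else 0)
      = ∑ i, Δ i * (if n i = true then (1 : ℝ) else 0) :=
    Fintype.sum_equiv φ _ _ fun i => by rw [hφ.1, confAct]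
  simp only [blockadeH, of_apply, hinj, hammingDist_confAct, hφ.excitedEdgeCount_confAct, hsum]

theorem IsBlockadeAut.mulVec_permMatrix_mulVec {Δ : Fin N → ℝ} {φ : Equiv.Perm (Fin N)}
    (hφ : IsBlockadeAut G Δ φ) (U₀ Ω : ℝ) (v : (Fin N → Bool) → ℝ) :
    blockadeH G Δ U₀ Ω *ᵥ (permMatrix ℝ φ *ᵥ v)
      = permMatrix ℝ φ *ᵥ (blockadeH G Δ U₀ Ω *ᵥ v) := by
  funext m
  obtain ⟨n, rfl⟩ := (confActEquiv φ).surjective m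
  rw [confActEquiv_apply, permMatrix_mulVec_confAct]
  simp only [mulVec, dotProduct]
  refine (Fintype.sum_equiv (confActEquiv φ) _ _ fun k => ?_).symm
  rw [confActEquiv_apply, hφ.blockadeH_confAct, ← permMatrix_mulVec_confAct φ v k]
  rfl

theorem blockadeH_isSymm (Δ : Fin N → ℝ) (U₀ Ω : ℝ) : (blockadeH G Δ U₀ Ω).IsSymm := by
  refine Matrix.IsSymm.ext fun n m => ?_
  rcases eq_or_ne n m with rfl | h
  · rfl
  · simp [blockadeH, h, h.symm, hammingDist_comm]

theorem blockadeH_sub_smul_one_apply_of_ne (Δ : Fin N → ℝ) (U₀ Ω μ : ℝ) {n m : Fin N → Bool}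
    (h : n ≠ m) : (blockadeH G Δ U₀ Ω - μ • (1 : Matrix (Fin N → Bool) (Fin N → Bool) ℝ)) n m
      = if hammingDist n m = 1 then Ω else 0 := by
  simp [blockadeH, h]

/-- A ground eigenvector of the blockade Hamiltonian has no vanishing entry. -/
theorem ne_zero_of_blockadeH_mulVec {Δ : Fin N → ℝ} {U₀ Ω : ℝ} (hΩ : Ω ≠ 0) {μ : ℝ}
    (hmin : ∀ μ' : ℝ,
      Module.End.HasEigenvalue (Matrix.toLin' (blockadeH G Δ U₀ Ω)) μ' → μ ≤ μ')
    {v : (Fin N → Bool) → ℝ} (hv : v ≠ 0) (heig : blockadeH G Δ U₀ Ω *ᵥ v = μ • v)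
    (n : Fin N → Bool) : v n ≠ 0 := by
  obtain ⟨σ, hσ, hσΩ⟩ : ∃ σ : ℝ, σ * σ = 1 ∧ σ * Ω = -|Ω| := by
    rcases hΩ.lt_or_gt with h | h
    · exact ⟨1, by norm_num, by rw [abs_of_neg h]; ring⟩
    · exact ⟨-1, by norm_num, by rw [abs_of_pos h]; ring⟩
  refine ((blockadeH_isSymm Δ U₀ Ω).posSemidef_sub_smul_one hmin).ne_zero_of_mulVec_eq_zero
    (s := configSign σ) (fun k => by rw [configSign_mul hσ, hammingDist_self, pow_zero])
    (fun k l hkl => ?_) (fun k l => ?_) hv ?_ n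
  · rw [configSign_mul hσ, blockadeH_sub_smul_one_apply_of_ne _ _ _ _ hkl]
    split_ifs with h
    · rw [h, pow_one, hσΩ]
    · simp
  · refine Relation.ReflTransGen.mono (fun a b hab => ?_) _ _
      (reflTransGen_hammingDist_eq_one k l)
    have hne : a ≠ b := by
      rintro rfl
      simp at hab
    rwa [blockadeH_sub_smul_one_apply_of_ne _ _ _ _ hne, if_pos hab]
  · rw [sub_mulVec, smul_mulVec, one_mulVec, heig, sub_self]

/-- Any two ground eigenvectors of the blockade Hamiltonian are proportional. -/
theorem eq_smul_of_blockadeH_mulVec {Δ : Fin N → ℝ} {U₀ Ω : ℝ} (hΩ : Ω ≠ 0) {μ : ℝ}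
    (hmin : ∀ μ' : ℝ,
      Module.End.HasEigenvalue (Matrix.toLin' (blockadeH G Δ U₀ Ω)) μ' → μ ≤ μ')
    {v w : (Fin N → Bool) → ℝ} (hv : v ≠ 0) (heig : blockadeH G Δ U₀ Ω *ᵥ v = μ • v)
    (hw : blockadeH G Δ U₀ Ω *ᵥ w = μ • w) (n : Fin N → Bool) :
    w = (w n / v n) • v := by
  have hn := ne_zero_of_blockadeH_mulVec hΩ hmin hv heig n
  rw [← sub_eq_zero]
  by_contra hne
  refine ne_zero_of_blockadeH_mulVec hΩ hmin hne ?_ n (by simp [hn])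
  rw [mulVec_sub, mulVec_smul, hw, heig, smul_sub, smul_comm]

end BlockadeHamiltonian

/-- If `Ω ≠ 0` and the blockade structure is fully-symmetric (the automorphism group acts
transitively on `L`), then the ground state of `H(Ω)` is unique up to scaling, the ground
eigenvector is invariant under every automorphism, and its entries are equal (to some `λ`)
on all logical states `n ∈ L`. -/
theorem fully_symmetric_equal_weight {N : ℕ} (G : SimpleGraph (Fin N))
    [DecidableRel G.Adj] (Δ : Fin N → ℝ) (U₀ Ω : ℝ) (hΩ : Ω ≠ 0)
    (hfull : ∀ n ∈ mwisConfigs G Δ, ∀ m ∈ mwisConfigs G Δ,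
      ∃ φ : Equiv.Perm (Fin N), IsBlockadeAut G Δ φ ∧ m = confAct φ n)
    (μ : ℝ)
    (hmin : ∀ μ' : ℝ,
      Module.End.HasEigenvalue (Matrix.toLin' (blockadeH G Δ U₀ Ω)) μ' → μ ≤ μ')
    (v : (Fin N → Bool) → ℝ) (hv : v ≠ 0)
    (heig : (blockadeH G Δ U₀ Ω).mulVec v = μ • v) :
    Module.finrank ℝ (Module.End.eigenspace (Matrix.toLin' (blockadeH G Δ U₀ Ω)) μ) = 1 ∧
    (∀ φ : Equiv.Perm (Fin N), IsBlockadeAut G Δ φ → (permMatrix ℝ φ).mulVec v = v) ∧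
    ∃ lam : ℝ, ∀ n ∈ mwisConfigs G Δ, v n = lam := by
  have hinv : ∀ φ : Equiv.Perm (Fin N), IsBlockadeAut G Δ φ →
      (permMatrix ℝ φ).mulVec v = v := by
    intro φ hφ
    have h := eq_smul_of_blockadeH_mulVec hΩ hmin hv heig
      (w := permMatrix ℝ φ *ᵥ v)
      (by rw [hφ.mulVec_permMatrix_mulVec, heig, mulVec_smul]) (confAct φ fun _ => false)
    rwa [permMatrix_mulVec_confAct, show (confAct φ fun _ => false) = fun _ => false from rfl,
      div_self (ne_zero_of_blockadeH_mulVec hΩ hmin hv heig _), one_smul] at h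
  refine ⟨?_, hinv, ?_⟩
  · have hmem : v ∈ Module.End.eigenspace (Matrix.toLin' (blockadeH G Δ U₀ Ω)) μ := by
      rwa [Module.End.mem_eigenspace_iff, Matrix.toLin'_apply]
    refine (finrank_eq_one_iff_of_nonzero' ⟨v, hmem⟩ (by simpa using hv)).2 fun w => ?_
    have hw := Module.End.mem_eigenspace_iff.1 w.2
    rw [Matrix.toLin'_apply] at hw
    exact ⟨_, Subtype.ext
      (eq_smul_of_blockadeH_mulVec hΩ hmin hv heig hw fun _ => false).symm⟩
  · rcases (mwisConfigs G Δ).eq_empty_or_nonempty with hL | ⟨n, hn⟩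
    · exact ⟨0, by simp [hL]⟩
    · refine ⟨v n, fun m hm => ?_⟩
      obtain ⟨φ, hφ, rfl⟩ := hfull n hn m hm
      rw [← permMatrix_mulVec_confAct φ v n, hinv φ hφ]
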